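/- Let γ: ℝ^d → ℝ^{m×m} be a pseudo cross-variogram with nonnegative entries which is not identically zero (i.e., γ_ij(h) > 0 for some h, i, j), and let a > 0, b ≥ 0. Define C: ℝ^d → ℝ^{m×m} by C_ij(h) = (1 + b·γ_ij(h)) / (1 + a·γ_ij(h)), i,j = 1,…,m. Then C is infinitely divisible — i.e., for every r > 0 the entrywise power (C_ij(h)^r)_{i,j=1,…,m} is a positive definite matrix-valued function — if and only if a ≥ b. -/

import Mathlib

open Matrix MeasureTheory Real Set
open scoped BigOperators

/-- A matrix-valued kernel `C : X × X → ℝ^{m×m}` is positive definite if it is symmetric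
(`C_ij(x,y) = C_ji(y,x)`) and all quadratic forms `∑_p ∑_q a_pᵀ C(x_p, x_q) a_q` are
nonnegative. -/
def IsPosDefKernel {X : Type*} {m : ℕ} (C : X → X → Matrix (Fin m) (Fin m) ℝ) : Prop :=
  (∀ x y i j, C x y i j = C y x j i) ∧
  ∀ (n : ℕ) (x : Fin n → X) (a : Fin n → Fin m → ℝ),
    0 ≤ ∑ p, ∑ q, a p ⬝ᵥ (C (x p) (x q)).mulVec (a q)

/-- A matrix-valued kernel `Γ : X × X → ℝ^{m×m}` is conditionally negative definite if it is
symmetric (`Γ_ij(x,y) = Γ_ji(y,x)`) and all quadratic forms `∑_p ∑_q a_pᵀ Γ(x_p, x_q) a_q`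
with `1_mᵀ ∑_p a_p = 0` are nonpositive. -/
def IsCondNegDefKernel {X : Type*} {m : ℕ} (Γ : X → X → Matrix (Fin m) (Fin m) ℝ) : Prop :=
  (∀ x y i j, Γ x y i j = Γ y x j i) ∧
  ∀ (n : ℕ) (x : Fin n → X) (a : Fin n → Fin m → ℝ),
    (∑ p, ∑ i, a p i) = 0 →
    ∑ p, ∑ q, a p ⬝ᵥ (Γ (x p) (x q)).mulVec (a q) ≤ 0

/-- A non-stationary pseudo cross-variogram: a conditionally negative definite matrix-valued
kernel vanishing on the diagonal of its diagonal components. -/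
def IsNSPseudoCrossVariogram {X : Type*} {m : ℕ}
    (Γ : X → X → Matrix (Fin m) (Fin m) ℝ) : Prop :=
  IsCondNegDefKernel Γ ∧ ∀ x i, Γ x x i i = 0

/-- A matrix-valued function is positive definite if the associated translation-invariant
kernel `(x, y) ↦ C (x - y)` is a positive definite kernel. -/
def IsPosDefFun {V : Type*} [AddCommGroup V] {m : ℕ}
    (C : V → Matrix (Fin m) (Fin m) ℝ) : Prop :=
  IsPosDefKernel (fun x y => C (x - y))

/-- A (stationary) pseudo cross-variogram: the kernel `(x,y) ↦ γ(x−y)` is conditionally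
negative definite and `γ_ii(0) = 0` for all `i`. -/
def IsPseudoCrossVariogram {V : Type*} [AddCommGroup V] {m : ℕ}
    (γ : V → Matrix (Fin m) (Fin m) ℝ) : Prop :=
  IsCondNegDefKernel (fun x y => γ (x - y)) ∧ ∀ i, γ 0 i i = 0

section FiniteMatrices

variable {ι : Type*} [Fintype ι]

/-- A real matrix is conditionally negative definite if it is symmetric and its quadratic form is
nonpositive on vectors whose entries sum to zero. -/
def Matrix.IsCondNegDef (M : Matrix ι ι ℝ) : Prop :=
  M.IsSymm ∧ ∀ v : ι → ℝ, ∑ i, v i = 0 → ∑ i, ∑ j, v i * M i j * v j ≤ 0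

theorem Matrix.posSemidef_real_iff {M : Matrix ι ι ℝ} :
    M.PosSemidef ↔ M.IsSymm ∧ ∀ v : ι → ℝ, 0 ≤ ∑ i, ∑ j, v i * M i j * v j := by
  rw [posSemidef_iff_dotProduct_mulVec, IsHermitian, conjTranspose_eq_transpose_of_trivial]
  simp [IsSymm, dotProduct, mulVec, Finset.mul_sum, mul_assoc]

theorem Matrix.PosSemidef.map_pow {M : Matrix ι ι ℝ} (hM : M.PosSemidef) (k : ℕ) :
    (M.map (· ^ k)).PosSemidef := by
  induction k with
  | zero =>
    refine posSemidef_real_iff.2 ⟨by ext; simp, fun v => ?_⟩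
    simpa [← Finset.mul_sum, ← Finset.sum_mul] using mul_self_nonneg (∑ i, v i)
  | succ k ih =>
    have h : M.map (· ^ (k + 1)) = (M.map (· ^ k)).hadamard M := by
      ext i j
      simp [pow_succ]
    exact h ▸ ih.hadamard hM

theorem Matrix.PosSemidef.map_exp {M : Matrix ι ι ℝ} (hM : M.PosSemidef) :
    (M.map Real.exp).PosSemidef := by
  refine posSemidef_real_iff.2 ⟨?_, fun v => ?_⟩
  · ext i j
    simp [(posSemidef_real_iff.1 hM).1.apply]
  have hexp (x : ℝ) : HasSum (fun k : ℕ => x ^ k / (k.factorial : ℝ)) (Real.exp x) := by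
    simpa [Real.exp_eq_exp_ℝ] using NormedSpace.expSeries_div_hasSum_exp (𝔸 := ℝ) x
  have h : HasSum (fun k : ℕ => ∑ i, ∑ j, v i * (M i j ^ k / (k.factorial : ℝ)) * v j)
      (∑ i, ∑ j, v i * Real.exp (M i j) * v j) :=
    hasSum_sum fun i _ => hasSum_sum fun j _ => ((hexp _).mul_left _).mul_right _
  refine h.nonneg fun k => ?_
  have hk := mul_nonneg (inv_nonneg.2 (Nat.cast_nonneg (α := ℝ) k.factorial))
    ((posSemidef_real_iff.1 (hM.map_pow k)).2 v)
  rw [Finset.mul_sum] at hk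
  refine hk.trans_eq (Finset.sum_congr rfl fun i _ => ?_)
  rw [Finset.mul_sum]
  refine Finset.sum_congr rfl fun j _ => ?_
  simp only [map_apply]
  ring

theorem Matrix.PosSemidef.mul_mul_real {M : Matrix ι ι ℝ} (hM : M.PosSemidef) (w : ι → ℝ) :
    (of fun i j => w i * M i j * w j).PosSemidef := by
  obtain ⟨hs, hq⟩ := posSemidef_real_iff.1 hM
  refine posSemidef_real_iff.2 ⟨?_, fun v => (hq fun i => v i * w i).trans_eq ?_⟩
  · ext i j
    simp [hs.apply i j]
    ring
  · refine Finset.sum_congr rfl fun i _ => Finset.sum_congr rfl fun j _ => ?_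
    simp only [of_apply]
    ring

/-- Centring a conditionally negative definite matrix at an index gives a positive semidefinite
matrix. -/
theorem Matrix.IsCondNegDef.posSemidef_centered {M : Matrix ι ι ℝ} (hM : M.IsCondNegDef) (o : ι) :
    (of fun i j => M i o + M o j - M i j - M o o).PosSemidef := by
  classical
  obtain ⟨hs, hq⟩ := hM
  refine posSemidef_real_iff.2 ⟨?_, fun v => ?_⟩
  · ext i j
    simp only [transpose_apply, of_apply, hs.apply i j, hs.apply i o, hs.apply j o]
    ring
  have h := hq (fun i => v i - if i = o then ∑ k, v k else 0) (by simp)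
  have h1 : ∑ i, ∑ j, (v i - if i = o then ∑ k, v k else 0) * M i j *
        (v j - if j = o then ∑ k, v k else 0) =
      ∑ i, ∑ j, v i * M i j * v j - (∑ k, v k) * ∑ j, M o j * v j
        - (∑ i, v i * M i o) * (∑ k, v k) + (∑ k, v k) * M o o * ∑ k, v k := by
    simp only [sub_mul, mul_sub, Finset.sum_sub_distrib, ite_mul, mul_ite, zero_mul, mul_zero,
      Finset.sum_ite_irrel, Finset.sum_const_zero, Finset.sum_ite_eq', Finset.mem_univ, if_true]
    simp only [mul_assoc, ← Finset.mul_sum]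
    simp only [← mul_assoc, ← Finset.sum_mul]
    ring
  have h2 : ∑ i, ∑ j, v i * (M i o + M o j - M i j - M o o) * v j =
      (∑ i, v i * M i o) * (∑ k, v k) + (∑ k, v k) * ∑ j, M o j * v j
        - ∑ i, ∑ j, v i * M i j * v j - (∑ k, v k) * M o o * ∑ k, v k := by
    simp only [mul_add, mul_sub, add_mul, sub_mul, Finset.sum_add_distrib,
      Finset.sum_sub_distrib, mul_assoc, ← Finset.mul_sum]
    simp only [← mul_assoc, ← Finset.sum_mul]
  simp only [of_apply]
  linarith

/-- Schoenberg's theorem for matrices: `exp (-M)`, taken entrywise, is positive semidefinite when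
`M` is conditionally negative definite. -/
theorem Matrix.IsCondNegDef.posSemidef_exp_neg {M : Matrix ι ι ℝ} (hM : M.IsCondNegDef) :
    (M.map fun x => Real.exp (-x)).PosSemidef := by
  rcases isEmpty_or_nonempty ι with _ | ⟨⟨o⟩⟩
  · exact posSemidef_real_iff.2 ⟨Subsingleton.elim _ _, by simp⟩
  · convert (hM.posSemidef_centered o).map_exp.mul_mul_real
      (fun i => Real.exp (M o o / 2 - M i o)) using 1
    ext i j
    simp only [map_apply, of_apply, ← Real.exp_add, hM.1.apply o j]
    ring_nf

theorem Matrix.IsCondNegDef.smul {M : Matrix ι ι ℝ} (hM : M.IsCondNegDef) {r : ℝ} (hr : 0 ≤ r) :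
    (r • M).IsCondNegDef := by
  refine ⟨hM.1.smul r, fun v hv => ?_⟩
  have h := mul_nonpos_of_nonneg_of_nonpos hr (hM.2 v hv)
  rw [Finset.mul_sum] at h
  refine h.trans_eq' (Finset.sum_congr rfl fun i _ => ?_)
  rw [Finset.mul_sum]
  refine Finset.sum_congr rfl fun j _ => ?_
  simp only [smul_apply, smul_eq_mul]
  ring

theorem Matrix.IsCondNegDef.posSemidef_inv_one_add_mul {M : Matrix ι ι ℝ} (hM : M.IsCondNegDef)
    (hnn : ∀ i j, 0 ≤ M i j) {s : ℝ} (hs : 0 ≤ s) :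
    (M.map fun x => (1 + s * x)⁻¹).PosSemidef := by
  refine posSemidef_real_iff.2 ⟨?_, fun v => ?_⟩
  · ext i j
    simp [hM.1.apply]
  have hneg (i j : ι) : -(1 + s * M i j) < 0 := by
    have := mul_nonneg hs (hnn i j)
    linarith
  have hint (i j : ι) : IntegrableOn (fun t : ℝ => v i * Real.exp (-(1 + s * M i j) * t) * v j)
      (Ioi 0) :=
    ((integrableOn_exp_mul_Ioi (hneg i j) 0).const_mul _).mul_const _
  have key : ∑ i, ∑ j, v i * (M.map fun x => (1 + s * x)⁻¹) i j * v j =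
      ∫ t in Ioi (0 : ℝ), ∑ i, ∑ j, v i * Real.exp (-(1 + s * M i j) * t) * v j := by
    rw [integral_finsetSum _ fun i _ => integrable_finsetSum _ fun j _ => hint i j]
    refine Finset.sum_congr rfl fun i _ => ?_
    rw [integral_finsetSum _ fun j _ => hint i j]
    refine Finset.sum_congr rfl fun j _ => ?_
    rw [integral_mul_const, integral_const_mul, integral_exp_mul_Ioi (hneg i j)]
    simp [neg_div_neg_eq, -neg_add_rev]
  rw [key]
  refine setIntegral_nonneg measurableSet_Ioi fun t ht => ?_
  have ht : 0 < t := ht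
  have h := mul_nonneg (Real.exp_pos (-t)).le
    ((posSemidef_real_iff.1 (hM.smul (mul_nonneg hs ht.le)).posSemidef_exp_neg).2 v)
  rw [Finset.mul_sum] at h
  refine h.trans_eq (Finset.sum_congr rfl fun i _ => ?_)
  rw [Finset.mul_sum]
  refine Finset.sum_congr rfl fun j _ => ?_
  have : Real.exp (-(1 + s * M i j) * t) = Real.exp (-t) * Real.exp (-(s * t * M i j)) := by
    rw [← Real.exp_add]
    ring_nf
  simp only [this, map_apply, smul_apply, smul_eq_mul]
  ring

theorem Matrix.IsCondNegDef.map_div_one_add_mul {M : Matrix ι ι ℝ} (hM : M.IsCondNegDef)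
    (hnn : ∀ i j, 0 ≤ M i j) {s : ℝ} (hs : 0 < s) :
    (M.map fun x => x / (1 + s * x)).IsCondNegDef := by
  refine ⟨by ext i j; simp [hM.1.apply], fun v hv => ?_⟩
  have h := mul_nonneg (inv_nonneg.2 hs.le)
    ((posSemidef_real_iff.1 (hM.posSemidef_inv_one_add_mul hnn hs.le)).2 v)
  have h0 : ∑ i, ∑ j, v i * s⁻¹ * v j = 0 := by
    simp [← Finset.mul_sum, hv]
  refine (sub_nonpos.2 h).trans_eq' ?_
  rw [← h0, Finset.mul_sum, ← Finset.sum_sub_distrib]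
  refine Finset.sum_congr rfl fun i _ => ?_
  rw [Finset.mul_sum, ← Finset.sum_sub_distrib]
  refine Finset.sum_congr rfl fun j _ => ?_
  have : 1 + s * M i j ≠ 0 := by
    have := mul_nonneg hs.le (hnn i j)
    positivity
  simp only [map_apply]
  field_simp
  ring

theorem Matrix.IsCondNegDef.map_log_sub_log {M : Matrix ι ι ℝ} (hM : M.IsCondNegDef)
    (hnn : ∀ i j, 0 ≤ M i j) {a b : ℝ} (hb : 0 ≤ b) (hba : b ≤ a) :
    (M.map fun x => Real.log (1 + a * x) - Real.log (1 + b * x)).IsCondNegDef := by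
  refine ⟨by ext i j; simp [hM.1.apply], fun v hv => ?_⟩
  have hpos {s : ℝ} (hs : 0 ≤ s) (i j : ι) : 1 + s * M i j ≠ 0 := by
    have := mul_nonneg hs (hnn i j)
    positivity
  have hderiv {s : ℝ} (hs : 0 ≤ s) :
      HasDerivAt (fun s => ∑ i, ∑ j, v i * Real.log (1 + s * M i j) * v j)
        (∑ i, ∑ j, v i * (M i j / (1 + s * M i j)) * v j) s := by
    refine HasDerivAt.fun_sum fun i _ => HasDerivAt.fun_sum fun j _ => ?_
    have h : HasDerivAt (fun s => 1 + s * M i j) (M i j) s := by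
      simpa using ((hasDerivAt_id s).mul_const (M i j)).const_add 1
    exact ((h.log (hpos hs i j)).const_mul _).mul_const _
  have hanti : AntitoneOn (fun s => ∑ i, ∑ j, v i * Real.log (1 + s * M i j) * v j) (Ici 0) := by
    refine antitoneOn_of_deriv_nonpos (convex_Ici 0)
      (fun s hs => (hderiv hs).continuousAt.continuousWithinAt)
      (fun s hs => (hderiv (interior_subset hs)).differentiableAt.differentiableWithinAt)
      fun s hs => ?_
    rw [(hderiv (interior_subset hs)).deriv]
    rw [interior_Ici] at hs
    exact (hM.map_div_one_add_mul hnn hs).2 v hv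
  refine (sub_nonpos.2 (hanti hb (hb.trans hba) hba)).trans_eq' ?_
  simp only [← Finset.sum_sub_distrib]
  simp [mul_sub, sub_mul]

theorem Matrix.IsCondNegDef.posSemidef_rpow_div {M : Matrix ι ι ℝ} (hM : M.IsCondNegDef)
    (hnn : ∀ i j, 0 ≤ M i j) {a b r : ℝ} (hb : 0 ≤ b) (hba : b ≤ a) (hr : 0 ≤ r) :
    (M.map fun x => ((1 + b * x) / (1 + a * x)) ^ r).PosSemidef := by
  convert ((hM.map_log_sub_log hnn hb hba).smul hr).posSemidef_exp_neg using 1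
  ext i j
  have hB : 0 < 1 + b * M i j := by
    have := mul_nonneg hb (hnn i j)
    positivity
  have hA : 0 < 1 + a * M i j := by
    have := mul_nonneg (hb.trans hba) (hnn i j)
    positivity
  simp only [map_apply, smul_apply, smul_eq_mul]
  rw [Real.rpow_def_of_pos (div_pos hB hA), Real.log_div hB.ne' hA.ne']
  ring_nf

end FiniteMatrices

section Kernels

variable {X : Type*} {m : ℕ}

theorem sum_dotProduct_mulVec_eq {n : ℕ} (K : X → X → Matrix (Fin m) (Fin m) ℝ)
    (x : Fin n → X) (c : Fin n → Fin m → ℝ) :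
    ∑ p, ∑ q, c p ⬝ᵥ (K (x p) (x q)).mulVec (c q) =
      ∑ s : Fin n × Fin m, ∑ t : Fin n × Fin m,
        c s.1 s.2 * K (x s.1) (x t.1) s.2 t.2 * c t.1 t.2 := by
  simp only [Fintype.sum_prod_type, dotProduct, mulVec, Finset.mul_sum, mul_assoc]
  exact Finset.sum_congr rfl fun p _ => Finset.sum_comm

theorem IsCondNegDefKernel.isCondNegDef {K : X → X → Matrix (Fin m) (Fin m) ℝ}
    (hK : IsCondNegDefKernel K) {n : ℕ} (x : Fin n → X) :
    (of fun s t : Fin n × Fin m => K (x s.1) (x t.1) s.2 t.2).IsCondNegDef := by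
  refine ⟨by ext s t; exact hK.1 _ _ _ _, fun v hv => ?_⟩
  have h := hK.2 n x (fun p i => v (p, i)) (by rw [← hv, Fintype.sum_prod_type])
  rwa [sum_dotProduct_mulVec_eq] at h

/-- A positive definite kernel whose diagonal entries at the diagonal are `1` is bounded by `1`. -/
theorem IsPosDefKernel.apply_le_one {K : X → X → Matrix (Fin m) (Fin m) ℝ}
    (hK : IsPosDefKernel K) (hdiag : ∀ x i, K x x i i = 1) (x y : X) (i j : Fin m) :
    K x y i j ≤ 1 := by
  have h := hK.2 2 ![x, y] ![Pi.single i 1, -Pi.single j 1]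
  simp [Fin.sum_univ_two, mulVec_neg, hdiag, hK.1 y x j i] at h
  linarith

end Kernels

/-- For a pseudo cross-variogram `γ` with nonnegative entries which is not
identically zero, `a > 0` and `b ≥ 0`, the function with entries
`C_ij(h) = (1 + b γ_ij(h)) / (1 + a γ_ij(h))` is infinitely divisible (all entrywise powers
`C^{*r}`, `r > 0`, are positive definite) if and only if `a ≥ b`. -/
theorem kosaki_ratio_infinitely_divisible_iff {d m : ℕ}
    (γ : (Fin d → ℝ) → Matrix (Fin m) (Fin m) ℝ)
    (hγ : IsPseudoCrossVariogram γ) (hnn : ∀ h i j, 0 ≤ γ h i j)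
    (hne : ∃ h i j, 0 < γ h i j)
    (a b : ℝ) (ha : 0 < a) (hb : 0 ≤ b) :
    (∀ r : ℝ, 0 < r → IsPosDefFun fun h => Matrix.of fun i j =>
      ((1 + b * γ h i j) / (1 + a * γ h i j)) ^ r) ↔ b ≤ a := by
  constructor
  · intro H
    obtain ⟨h, i, j, hpos⟩ := hne
    have hle := (H 1 one_pos).apply_le_one (fun x k => by simp [hγ.2]) h 0 i j
    have hA : 0 < 1 + a * γ h i j := by positivity
    simp only [sub_zero, of_apply, Real.rpow_one, div_le_one hA] at hle
    exact le_of_mul_le_mul_right (by linarith) hpos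
  · intro hba r hr
    refine ⟨fun x y i j => ?_, fun n x c => ?_⟩
    · simp only [of_apply, hγ.1.1 x y i j]
    · rw [sum_dotProduct_mulVec_eq (fun x y => Matrix.of fun i j =>
        ((1 + b * γ (x - y) i j) / (1 + a * γ (x - y) i j)) ^ r)]
      exact (posSemidef_real_iff.1 ((hγ.1.isCondNegDef x).posSemidef_rpow_div
        (fun _ _ => hnn _ _ _) hb hba hr.le)).2 fun s => c s.1 s.2
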